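/- Let J be a sparse symmetric shifted ideal in Z, let f ∈ G(J) with associated partition λ(f) = (λ_1 ≤ … ≤ λ_s) and f = ∏_{i : λ_i>0} z_{σ(i),λ_i} for some σ ∈ S_s, and set max(f) = max{σ(k) : λ_k = λ_s}. Then a variable z of Z belongs to the colon ideal (J_f : f) if and only if z lies in the disjoint union of the three sets: {z_{σ(i),j} : λ_i > 0 and 1 ≤ j < λ_i}, {z_{σ(i),j} : λ_i = 0 and 1 ≤ j < λ_s}, and {z_{σ(i),λ_s} : λ_i = 0 and σ(i) < max(f)}. -/

import Mathlib

open MvPolynomial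

/-- The sparse squarefree monomial `z^μ = ∏_{i : μ i > 0} z_{i, μ i}`, where the variable
`z_{i,j}` (for `1 ≤ j ≤ b`) is represented by `X (i, j-1)`. -/
noncomputable def sparseMon (K : Type*) [Field K] (s b : ℕ) (μ : Fin s → ℕ) :
    MvPolynomial (Fin s × Fin b) K :=
  ∏ i : Fin s, ∏ j : Fin b, if μ i = (j : ℕ) + 1 then X (i, j) else 1

/-- `μ' ≤₀ μ`. -/
def leZero {s : ℕ} (μ' μ : Fin s → ℕ) : Prop :=
  ∀ i, μ' i ≤ μ i ∧ (μ' i = 0 ↔ μ i = 0)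

/-- The action of `σ ∈ S_s` on `Z`, sending `z_{i,j}` to `z_{σ i, j}`. -/
noncomputable def permMap (K : Type*) [Field K] (s b : ℕ) (σ : Equiv.Perm (Fin s)) :
    MvPolynomial (Fin s × Fin b) K →ₐ[K] MvPolynomial (Fin s × Fin b) K :=
  rename fun p => (σ p.1, p.2)

/-- `z^μ` is a minimal monomial generator of the monomial ideal `J`. -/
def IsMinSparseGen (K : Type*) [Field K] (s b : ℕ)
    (J : Ideal (MvPolynomial (Fin s × Fin b) K)) (μ : Fin s → ℕ) : Prop :=
  (∀ i, μ i ≤ b) ∧ sparseMon K s b μ ∈ J ∧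
    ∀ i, 0 < μ i → sparseMon K s b (Function.update μ i 0) ∉ J

/-- A proper monomial ideal `J` of `Z` is sparse symmetric shifted if (S-1) it is generated
by sparse squarefree monomials, (S-2) for every minimal monomial generator `z^μ` and every
`μ' ≤₀ μ` one has `z^{μ'} ∈ J`, and (S-3) `σ(J) = J` for every permutation `σ`. -/
def IsSSS (K : Type*) [Field K] (s b : ℕ)
    (J : Ideal (MvPolynomial (Fin s × Fin b) K)) : Prop :=
  J ≠ ⊤ ∧
  (∃ S : Set (Fin s → ℕ), (∀ μ ∈ S, ∀ i, μ i ≤ b) ∧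
      J = Ideal.span (sparseMon K s b '' S)) ∧
  (∀ μ : Fin s → ℕ, IsMinSparseGen K s b J μ →
      ∀ μ' : Fin s → ℕ, leZero μ' μ → sparseMon K s b μ' ∈ J) ∧
  (∀ σ : Equiv.Perm (Fin s), Ideal.map (permMap K s b σ) J = J)

/-- The support degree: number of nonzero entries. -/
def suppdeg {s : ℕ} (ν : Fin s → ℕ) : ℕ := (Finset.univ.filter fun i => ν i ≠ 0).card

/-- The weight: sum of the entries. -/
def wt {s : ℕ} (ν : Fin s → ℕ) : ℕ := ∑ i, ν i

/-- The associated partition: the nondecreasing rearrangement of the tuple. -/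
noncomputable def partOf {s : ℕ} (ν : Fin s → ℕ) : Fin s → ℕ := ν ∘ Tuple.sort ν

/-- Exponent vector of the sparse squarefree monomial `z^ν`. -/
def exps {s b : ℕ} (ν : Fin s → ℕ) : Fin s × Fin b → ℕ :=
  fun p => if ν p.1 = (p.2 : ℕ) + 1 then 1 else 0

/-- `z^ν >_lex z^{ν'}` for the lexicographic order on monomials induced by the variable
order `z_{i,j} > z_{i',j'}` iff `j < j'`, or `j = j'` and `i < i'`. -/
def monLexGT {s : ℕ} (b : ℕ) (ν ν' : Fin s → ℕ) : Prop :=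
  ∃ v : Fin s × Fin b, exps ν' v < exps ν v ∧
    ∀ w : Fin s × Fin b,
      ((w.2 : ℕ) < (v.2 : ℕ) ∨ ((w.2 : ℕ) = (v.2 : ℕ) ∧ (w.1 : ℕ) < (v.1 : ℕ))) →
        exps (b := b) ν w = exps ν' w

/-- The order `≺` on tuples: first compare support degrees, then weights, then the
leftmost nonzero entry of the difference must be negative. -/
def partLT {s : ℕ} (l l' : Fin s → ℕ) : Prop :=
  suppdeg l < suppdeg l' ∨
  (suppdeg l = suppdeg l' ∧ wt l < wt l') ∨
  (suppdeg l = suppdeg l' ∧ wt l = wt l' ∧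
    ∃ i : Fin s, l i < l' i ∧ ∀ j : Fin s, j < i → l j = l' j)

/-- The order `≺` on (tuples representing) minimal monomial generators:
`f₁ ≺ f₂` iff `λ(f₁) ≺ λ(f₂)`, or `λ(f₁) = λ(f₂)` and `f₁ >_lex f₂`. -/
def genPrec {s : ℕ} (b : ℕ) (ν ν' : Fin s → ℕ) : Prop :=
  partLT (partOf ν) (partOf ν') ∨ (partOf ν = partOf ν' ∧ monLexGT b ν ν')

/-- `J_f = ⟨g ∈ G(J) : g ≺ f⟩`, where `f = z^ν`. -/
noncomputable def Jf (K : Type*) [Field K] (s b : ℕ)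
    (J : Ideal (MvPolynomial (Fin s × Fin b) K)) (ν : Fin s → ℕ) :
    Ideal (MvPolynomial (Fin s × Fin b) K) :=
  Ideal.span {g | ∃ ν' : Fin s → ℕ,
    IsMinSparseGen K s b J ν' ∧ genPrec b ν' ν ∧ g = sparseMon K s b ν'}

/-- The exponent vector of `z^μ` as a finitely supported function. -/
noncomputable def expsFinsupp {s : ℕ} (b : ℕ) (μ : Fin s → ℕ) : Fin s × Fin b →₀ ℕ :=
  Finsupp.equivFunOnFinite.symm (exps μ)

@[simp]
lemma expsFinsupp_apply {s b : ℕ} (μ : Fin s → ℕ) (q : Fin s × Fin b) :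
    expsFinsupp b μ q = exps μ q := rfl

lemma sparseMon_eq_monomial (K : Type*) [Field K] (s b : ℕ) (μ : Fin s → ℕ) :
    sparseMon K s b μ = monomial (expsFinsupp b μ) 1 := by
  rw [monomial_eq, map_one, one_mul, Finsupp.prod_fintype _ _ (by simp), Fintype.prod_prod_type]
  refine Finset.prod_congr rfl fun i _ => Finset.prod_congr rfl fun j _ => ?_
  by_cases h : μ i = (j : ℕ) + 1 <;> simp [exps, h]

lemma sparseMon_dvd {K : Type*} [Field K] {s b : ℕ} {μ ν : Fin s → ℕ}
    (h : ∀ i, μ i = 0 ∨ μ i = ν i) : sparseMon K s b μ ∣ sparseMon K s b ν := by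
  refine Finset.prod_dvd_prod_of_dvd _ _ fun i _ =>
    Finset.prod_dvd_prod_of_dvd _ _ fun j _ => ?_
  rcases h i with h | h <;> simp [h]

lemma permMap_sparseMon {K : Type*} [Field K] {s b : ℕ} (τ : Equiv.Perm (Fin s))
    (μ : Fin s → ℕ) :
    permMap K s b τ (sparseMon K s b μ) = sparseMon K s b (μ ∘ τ.symm) := by
  simp only [permMap, sparseMon, map_prod]
  refine Fintype.prod_equiv τ _ _ fun i => Finset.prod_congr rfl fun j _ => ?_
  simp only [Function.comp_apply, Equiv.symm_apply_apply]
  split_ifs <;> simp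

lemma IsSSS.sparseMon_comp_mem {K : Type*} [Field K] {s b : ℕ}
    {J : Ideal (MvPolynomial (Fin s × Fin b) K)} (hJ : IsSSS K s b J)
    (τ : Equiv.Perm (Fin s)) {μ : Fin s → ℕ} (h : sparseMon K s b μ ∈ J) :
    sparseMon K s b (μ ∘ τ) ∈ J := by
  have h2 := Ideal.mem_map_of_mem (permMap K s b τ.symm) h
  rwa [hJ.2.2.2, permMap_sparseMon, Equiv.symm_symm] at h2

lemma IsMinSparseGen.eq_of_mem {K : Type*} [Field K] {s b : ℕ}
    {J : Ideal (MvPolynomial (Fin s × Fin b) K)} {μ ν : Fin s → ℕ}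
    (hν : IsMinSparseGen K s b J ν) (hμ : sparseMon K s b μ ∈ J)
    (h : ∀ i, μ i = 0 ∨ μ i = ν i) : μ = ν := by
  by_contra hne
  obtain ⟨i, hi⟩ := Function.ne_iff.1 hne
  have h0 : μ i = 0 := (h i).resolve_right hi
  refine hν.2.2 i (by omega) (Ideal.mem_of_dvd J (sparseMon_dvd fun k => ?_) hμ)
  rcases eq_or_ne k i with rfl | hk
  · exact Or.inl h0
  · simpa [Function.update_of_ne hk] using h k

lemma suppdeg_comp {s : ℕ} (ν : Fin s → ℕ) (τ : Equiv.Perm (Fin s)) :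
    suppdeg (ν ∘ τ) = suppdeg ν := by
  simp only [suppdeg, Finset.card_filter, Function.comp_apply]
  exact Equiv.sum_comp τ fun i => if ν i ≠ 0 then 1 else 0

lemma wt_comp {s : ℕ} (ν : Fin s → ℕ) (τ : Equiv.Perm (Fin s)) : wt (ν ∘ τ) = wt ν :=
  Equiv.sum_comp τ ν

lemma partOf_comp {s : ℕ} (ν : Fin s → ℕ) (τ : Equiv.Perm (Fin s)) :
    partOf (ν ∘ τ) = partOf ν :=
  Tuple.comp_perm_comp_sort_eq_comp_sort

lemma suppdeg_lt_suppdeg {s : ℕ} {μ ν : Fin s → ℕ} (h : ∀ i, μ i = 0 ∨ μ i = ν i)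
    (hne : μ ≠ ν) : suppdeg μ < suppdeg ν := by
  obtain ⟨i, hi⟩ := Function.ne_iff.1 hne
  refine Finset.card_lt_card (Finset.ssubset_iff_of_subset ?_ |>.2 ⟨i, ?_, ?_⟩)
  · intro k hk
    have := h k
    simp only [Finset.mem_filter, Finset.mem_univ, true_and] at hk ⊢
    omega
  · have := h i
    simp only [Finset.mem_filter, Finset.mem_univ, true_and]
    omega
  · have := h i
    simp only [Finset.mem_filter, Finset.mem_univ, true_and]
    omega

lemma exists_isMinSparseGen {K : Type*} [Field K] {s b : ℕ}
    {J : Ideal (MvPolynomial (Fin s × Fin b) K)} (μ : Fin s → ℕ) (hb : ∀ i, μ i ≤ b)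
    (hμ : sparseMon K s b μ ∈ J) :
    ∃ ν, IsMinSparseGen K s b J ν ∧ ∀ i, ν i = 0 ∨ ν i = μ i := by
  by_cases hmin : IsMinSparseGen K s b J μ
  · exact ⟨μ, hmin, fun i => Or.inr rfl⟩
  · simp only [IsMinSparseGen, hμ, true_and, not_and, not_forall, not_not] at hmin
    obtain ⟨i, hi, hmem⟩ := hmin hb
    have hsub : ∀ k, Function.update μ i 0 k = 0 ∨ Function.update μ i 0 k = μ k := by
      intro k
      rcases eq_or_ne k i with rfl | hk <;> simp [*]
    have hlt : suppdeg (Function.update μ i 0) < suppdeg μ :=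
      suppdeg_lt_suppdeg hsub fun h => hi.ne (by simpa using congrFun h i)
    obtain ⟨ν, hν, h⟩ := exists_isMinSparseGen (Function.update μ i 0)
      (fun k => by rcases hsub k with h | h <;> simp [h, hb]) hmem
    refine ⟨ν, hν, fun k => ?_⟩
    have h1 := h k
    have h2 := hsub k
    omega
termination_by suppdeg μ

lemma genPrec_of_suppdeg_lt {s : ℕ} (b : ℕ) {μ ν : Fin s → ℕ} (h : suppdeg μ < suppdeg ν) :
    genPrec b μ ν := by
  refine Or.inl (Or.inl ?_)
  rwa [partOf, partOf, suppdeg_comp, suppdeg_comp]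

lemma genPrec_of_wt_lt {s : ℕ} (b : ℕ) {μ ν : Fin s → ℕ} (h : suppdeg μ = suppdeg ν)
    (hw : wt μ < wt ν) : genPrec b μ ν := by
  refine Or.inl (Or.inr (Or.inl ?_))
  simpa only [partOf, suppdeg_comp, wt_comp] using And.intro h hw

lemma genPrec.suppdeg_le {s b : ℕ} {μ ν : Fin s → ℕ} (h : genPrec b μ ν) :
    suppdeg μ ≤ suppdeg ν := by
  rw [← suppdeg_comp μ (Tuple.sort μ), ← suppdeg_comp ν (Tuple.sort ν)]
  rcases h with (h | h | h) | h
  · exact h.le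
  · exact h.1.le
  · exact h.1.le
  · exact (congrArg suppdeg h.1).le

lemma genPrec.wt_le {s b : ℕ} {μ ν : Fin s → ℕ} (h : genPrec b μ ν)
    (hd : suppdeg μ = suppdeg ν) : wt μ ≤ wt ν := by
  rw [← suppdeg_comp μ (Tuple.sort μ), ← suppdeg_comp ν (Tuple.sort ν)] at hd
  rw [← wt_comp μ (Tuple.sort μ), ← wt_comp ν (Tuple.sort ν)]
  rcases h with (h | h | h) | h
  · exact absurd hd h.ne
  · exact h.2.le
  · exact h.2.1.le
  · exact (congrArg wt h.1).le

lemma genPrec.monLexGT {s b : ℕ} {μ ν : Fin s → ℕ} (h : genPrec b μ ν)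
    (hp : partOf μ = partOf ν) : monLexGT b μ ν := by
  rcases h with h | h
  · rw [partLT, hp] at h
    simp at h
  · exact h.2

lemma not_genPrec_self {s b : ℕ} (μ : Fin s → ℕ) : ¬ genPrec b μ μ := fun h => by
  obtain ⟨v, hv, -⟩ := h.monLexGT rfl
  exact lt_irrefl _ hv

/-- A transposition moving a positive entry `μ q` to an earlier position with entry `0`
increases the monomial in the lexicographic order. -/
lemma genPrec_comp_swap {s b : ℕ} {μ : Fin s → ℕ} {p q : Fin s} (hp : μ p = 0)
    (hq : 0 < μ q) (hqb : μ q ≤ b) (hpq : p < q) : genPrec b (μ ∘ Equiv.swap p q) μ := by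
  refine Or.inr ⟨partOf_comp _ _, (p, ⟨μ q - 1, by omega⟩), ?_, ?_⟩
  · simp only [exps, Function.comp_apply, Equiv.swap_apply_left, hp]
    rw [if_neg (by omega), if_pos (by omega)]
    exact one_pos
  · rintro ⟨i, j⟩ h
    simp only at h
    rcases eq_or_ne i p with rfl | hip
    · simp only [exps, Function.comp_apply, Equiv.swap_apply_left, hp]
      rw [if_neg (by omega), if_neg (by omega)]
    rcases eq_or_ne i q with rfl | hiq
    · simp only [exps, Function.comp_apply, Equiv.swap_apply_right, hp]
      rw [if_neg (by omega), if_neg (by omega)]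
    · simp only [exps, Function.comp_apply, Equiv.swap_apply_of_ne_of_ne hip hiq]

/-- Conversely to `genPrec_comp_swap`, a transposition of a zero entry with a positive one only
gives a smaller element if the positive entry moves to an earlier position. -/
lemma lt_of_genPrec_comp_swap {s b : ℕ} {μ : Fin s → ℕ} {p q : Fin s} (hp : μ p = 0)
    (hq : 0 < μ q) (hqb : μ q ≤ b) (h : genPrec b (μ ∘ Equiv.swap p q) μ) : p < q := by
  by_contra hle
  have hne : p ≠ q := by rintro rfl; omega
  have hqp : q < p := lt_of_le_of_ne (not_lt.1 hle) hne.symm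
  obtain ⟨⟨i, j⟩, hv, hw⟩ := h.monLexGT (partOf_comp _ _)
  rcases eq_or_ne i p with rfl | hip
  · have hj : μ q = (j : ℕ) + 1 := by
      by_contra hj
      simp [exps, hj] at hv
    have := hw (q, j) (Or.inr ⟨rfl, hqp⟩)
    simp [exps, hj, hp] at this
  rcases eq_or_ne i q with rfl | hiq
  · simp [exps, hp] at hv
  · simp [exps, Equiv.swap_apply_of_ne_of_ne hip hiq] at hv

lemma wt_update {s : ℕ} (μ : Fin s → ℕ) (i : Fin s) (c : ℕ) :
    wt (Function.update μ i c) + μ i = wt μ + c := by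
  rw [wt, wt, Finset.sum_update_of_mem (Finset.mem_univ i),
    ← Finset.add_sum_erase _ μ (Finset.mem_univ i), Finset.sdiff_singleton_eq_erase]
  ring

lemma suppdeg_update {s : ℕ} (μ : Fin s → ℕ) (i : Fin s) {c : ℕ} (hi : μ i ≠ 0)
    (hc : c ≠ 0) : suppdeg (Function.update μ i c) = suppdeg μ := by
  refine congrArg Finset.card (Finset.filter_congr fun k _ => ?_)
  rcases eq_or_ne k i with rfl | hk <;> simp [*]

lemma leZero_update {s : ℕ} {μ : Fin s → ℕ} {i : Fin s} {c : ℕ} (hc : 0 < c)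
    (hle : c ≤ μ i) : leZero (Function.update μ i c) μ := by
  intro k
  rcases eq_or_ne k i with rfl | hk
  · simp only [Function.update_self]
    omega
  · simp [Function.update_of_ne hk]

lemma mem_colon_Jf_iff {K : Type*} [Field K] {s b : ℕ}
    {J : Ideal (MvPolynomial (Fin s × Fin b) K)} {ν : Fin s → ℕ} {p : Fin s × Fin b} :
    X p ∈ Submodule.colon (Jf K s b J ν) (Ideal.span {sparseMon K s b ν}) ↔
      ∃ ν', IsMinSparseGen K s b J ν' ∧ genPrec b ν' ν ∧
        ∀ q, ν' q = 0 ∨ ν' q = ν q ∨ (q = p.1 ∧ ν' q = (p.2 : ℕ) + 1) := by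
  have hJf : Jf K s b J ν = Ideal.span ((fun e => monomial e (1 : K)) ''
      {e | ∃ ν', IsMinSparseGen K s b J ν' ∧ genPrec b ν' ν ∧ e = expsFinsupp b ν'}) := by
    rw [Jf]
    congr 1
    ext g
    simp only [Set.mem_ofPred_eq, Set.mem_image, sparseMon_eq_monomial]
    constructor
    · rintro ⟨ν', h1, h2, rfl⟩
      exact ⟨_, ⟨ν', h1, h2, rfl⟩, rfl⟩
    · rintro ⟨_, ⟨ν', h1, h2, rfl⟩, rfl⟩
      exact ⟨ν', h1, h2, rfl⟩
  have hmul : (X p : MvPolynomial (Fin s × Fin b) K) * sparseMon K s b ν =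
      monomial (Finsupp.single p 1 + expsFinsupp b ν) 1 := by
    rw [sparseMon_eq_monomial, X, monomial_mul, one_mul]
  have hcol : X p ∈ Submodule.colon (Jf K s b J ν) (Ideal.span {sparseMon K s b ν}) ↔
      X p * sparseMon K s b ν ∈ Jf K s b J ν :=
    Ideal.mem_colon_span_singleton
  classical
  rw [hcol, hmul, hJf, mem_ideal_span_monomial_image, support_monomial, if_neg one_ne_zero]
  simp only [Finset.mem_singleton, forall_eq, Set.mem_ofPred_eq]
  constructor
  · rintro ⟨_, ⟨ν', h1, h2, rfl⟩, hle⟩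
    refine ⟨ν', h1, h2, fun q => ?_⟩
    by_contra! hq
    have hqb := h1.1 q
    have := hle (q, ⟨ν' q - 1, by omega⟩)
    rw [Finsupp.add_apply, expsFinsupp_apply, expsFinsupp_apply, Finsupp.single_eq_of_ne] at this
    · simp only [exps] at this
      rw [if_pos (by omega), if_neg (by omega)] at this
      omega
    · intro hqp
      have h3 := hq.2.2 (congrArg Prod.fst hqp)
      have h4 := congrArg (fun x => (x.2 : ℕ)) hqp
      simp only at h4
      omega
  · rintro ⟨ν', h1, h2, hq⟩
    refine ⟨_, ⟨ν', h1, h2, rfl⟩, ?_⟩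
    rintro ⟨i, j⟩
    rw [Finsupp.add_apply, expsFinsupp_apply, expsFinsupp_apply]
    simp only [exps]
    by_cases hij : ν' i = (j : ℕ) + 1
    · rw [if_pos hij]
      rcases hq i with h | h | ⟨h, h'⟩
      · omega
      · rw [← h, if_pos hij]
        omega
      · have : p = (i, j) := Prod.ext h.symm (Fin.ext (Nat.succ.inj (h'.symm.trans hij)))
        simp [this]
    · rw [if_neg hij]
      exact Nat.zero_le _

/-- It suffices to exhibit an element `z^μ` of `J`, not necessarily a minimal generator. -/
lemma mem_colon_Jf_of_mem {K : Type*} [Field K] {s b : ℕ}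
    {J : Ideal (MvPolynomial (Fin s × Fin b) K)} {μ ν : Fin s → ℕ} {p : Fin s × Fin b}
    (hb : ∀ i, μ i ≤ b) (hμ : sparseMon K s b μ ∈ J) (hprec : genPrec b μ ν)
    (h : ∀ q, μ q = 0 ∨ μ q = ν q ∨ (q = p.1 ∧ μ q = (p.2 : ℕ) + 1)) :
    X p ∈ Submodule.colon (Jf K s b J ν) (Ideal.span {sparseMon K s b ν}) := by
  obtain ⟨ν', hmin, hsub⟩ := exists_isMinSparseGen μ hb hμ
  refine mem_colon_Jf_iff.2 ⟨ν', hmin, ?_, fun q => ?_⟩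
  · rcases eq_or_ne ν' μ with rfl | hne
    · exact hprec
    · exact genPrec_of_suppdeg_lt b ((suppdeg_lt_suppdeg hsub hne).trans_le hprec.suppdeg_le)
  · rcases hsub q with h' | h'
    · exact Or.inl h'
    · rw [h']
      exact h q

/-- A replacement of a positive entry by a variable in the same row. -/
lemma mem_colon_Jf_iff_of_pos {K : Type*} [Field K] {s b : ℕ}
    {J : Ideal (MvPolynomial (Fin s × Fin b) K)} (hJ : IsSSS K s b J) {ν : Fin s → ℕ}
    (hν : IsMinSparseGen K s b J ν) {p : Fin s × Fin b} (hp : 0 < ν p.1) :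
    X p ∈ Submodule.colon (Jf K s b J ν) (Ideal.span {sparseMon K s b ν}) ↔
      (p.2 : ℕ) + 1 < ν p.1 := by
  constructor
  · intro h
    obtain ⟨ν', hmin, hprec, hq⟩ := mem_colon_Jf_iff.1 h
    by_contra! hle
    have hpe : ν' p.1 ≠ 0 ∧ ν' p.1 ≠ ν p.1 := by
      by_contra hcon
      have : ν' = ν := hν.eq_of_mem hmin.2.1 fun q => by
        rcases hq q with h | h | ⟨rfl, h⟩
        · exact Or.inl h
        · exact Or.inr h
        · omega
      exact not_genPrec_self ν (this ▸ hprec)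
    have hpv : ν' p.1 = (p.2 : ℕ) + 1 := by
      rcases hq p.1 with h | h | h
      · exact absurd h hpe.1
      · exact absurd h hpe.2
      · exact h.2
    have heq : Function.update ν' p.1 (ν p.1) = ν := by
      refine hν.eq_of_mem (hJ.2.2.1 ν' hmin _ (leZero_update hp (by omega))) fun q => ?_
      rcases eq_or_ne q p.1 with rfl | hne
      · simp
      · rw [Function.update_of_ne hne]
        rcases hq q with h | h | h
        · exact Or.inl h
        · exact Or.inr h
        · exact absurd h.1 hne
    have hd := suppdeg_update ν' p.1 hpe.1 hp.ne'
    have hw := wt_update ν' p.1 (ν p.1)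
    rw [heq] at hd hw
    have := hprec.wt_le hd.symm
    omega
  · intro h
    have hle : leZero (Function.update ν p.1 ((p.2 : ℕ) + 1)) ν :=
      leZero_update (Nat.succ_pos _) h.le
    refine mem_colon_Jf_of_mem (fun q => (hle q).1.trans (hν.1 q)) (hJ.2.2.1 ν hν _ hle)
      (genPrec_of_wt_lt b (suppdeg_update _ _ hp.ne' (Nat.succ_ne_zero _)) ?_) fun q => ?_
    · have := wt_update ν p.1 ((p.2 : ℕ) + 1)
      omega
    · rcases eq_or_ne q p.1 with rfl | hne
      · simp
      · simp [Function.update_of_ne hne]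

/-- A replacement of a positive entry by a variable in a row with entry zero. -/
lemma mem_colon_Jf_iff_of_eq_zero {K : Type*} [Field K] {s b : ℕ}
    {J : Ideal (MvPolynomial (Fin s × Fin b) K)} (hJ : IsSSS K s b J) {ν : Fin s → ℕ}
    (hν : IsMinSparseGen K s b J ν) {p : Fin s × Fin b} (hp : ν p.1 = 0) :
    X p ∈ Submodule.colon (Jf K s b J ν) (Ideal.span {sparseMon K s b ν}) ↔
      ∃ k, (p.2 : ℕ) + 1 < ν k ∨ ((p.2 : ℕ) + 1 = ν k ∧ p.1 < k) := by
  constructor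
  · intro h
    obtain ⟨ν', hmin, hprec, hq⟩ := mem_colon_Jf_iff.1 h
    by_contra! hcon
    have hpe : ν' p.1 ≠ 0 := by
      intro h0
      have : ν' = ν := hν.eq_of_mem hmin.2.1 fun q => by
        rcases hq q with h | h | ⟨rfl, h⟩
        · exact Or.inl h
        · exact Or.inr h
        · omega
      exact not_genPrec_self ν (this ▸ hprec)
    have hpv : ν' p.1 = (p.2 : ℕ) + 1 := by
      rcases hq p.1 with h | h | h
      · exact absurd h hpe
      · omega
      · exact h.2
    obtain ⟨k, hk, hk0⟩ : ∃ k, ν k ≠ 0 ∧ ν' k = 0 := by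
      by_contra! hall
      refine hprec.suppdeg_le.not_gt (Finset.card_lt_card
        (Finset.ssubset_iff_of_subset ?_ |>.2 ⟨p.1, ?_, ?_⟩))
      · intro q hq
        simp only [Finset.mem_filter, Finset.mem_univ, true_and] at hq ⊢
        exact hall q hq
      · simpa using hpe
      · simpa using hp
    have hkp : k ≠ p.1 := by
      rintro rfl
      exact hk hp
    have hkle : ν k ≤ (p.2 : ℕ) + 1 := (hcon k).1
    have heq : Function.update ν' p.1 (ν k) ∘ Equiv.swap p.1 k = ν := by
      refine hν.eq_of_mem (hJ.sparseMon_comp_mem _ (hJ.2.2.1 ν' hmin _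
        (leZero_update (Nat.pos_of_ne_zero hk) (by omega)))) fun q => ?_
      rw [Function.comp_apply]
      rcases eq_or_ne q p.1 with rfl | hqp
      · rw [Equiv.swap_apply_left, Function.update_of_ne hkp]
        exact Or.inl hk0
      rcases eq_or_ne q k with rfl | hqk
      · simp
      · rw [Equiv.swap_apply_of_ne_of_ne hqp hqk, Function.update_of_ne hqp]
        rcases hq q with h | h | h
        · exact Or.inl h
        · exact Or.inr h
        · exact absurd h.1 hqp
    have hd := suppdeg_update ν' p.1 hpe hk
    have hw := wt_update ν' p.1 (ν k)
    rw [← suppdeg_comp _ (Equiv.swap p.1 k), heq] at hd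
    rw [← wt_comp _ (Equiv.swap p.1 k), heq] at hw
    have hwle := hprec.wt_le hd.symm
    have hkeq : ν k = ν' p.1 := by omega
    have hν' : ν' = ν ∘ Equiv.swap p.1 k := by
      conv_rhs => rw [← heq]
      rw [hkeq, Function.update_eq_self]
      ext q
      simp
    rw [hν'] at hprec
    exact ((hcon k).2 (by omega)).not_gt
      (lt_of_genPrec_comp_swap hp (Nat.pos_of_ne_zero hk) (hν.1 k) hprec)
  · rintro ⟨k, hk⟩
    have hk0 : 0 < ν k := by omega
    have hkp : k ≠ p.1 := by
      rintro rfl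
      omega
    have hle : leZero (Function.update ν k ((p.2 : ℕ) + 1)) ν :=
      leZero_update (Nat.succ_pos _) (by omega)
    refine mem_colon_Jf_of_mem (μ := Function.update ν k ((p.2 : ℕ) + 1) ∘ Equiv.swap p.1 k)
      (fun q => (hle _).1.trans (hν.1 _)) (hJ.sparseMon_comp_mem _ (hJ.2.2.1 ν hν _ hle))
      ?_ fun q => ?_
    · rcases hk with hk | ⟨hk, hlt⟩
      · have := wt_update ν k ((p.2 : ℕ) + 1)
        refine genPrec_of_wt_lt b ?_ ?_
        · rw [suppdeg_comp, suppdeg_update _ _ hk0.ne' (Nat.succ_ne_zero _)]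
        · rw [wt_comp]
          omega
      · rw [hk, Function.update_eq_self]
        exact genPrec_comp_swap hp hk0 (hν.1 k) hlt
    · rw [Function.comp_apply]
      rcases eq_or_ne q p.1 with rfl | hqp
      · simp
      rcases eq_or_ne q k with rfl | hqk
      · rw [Equiv.swap_apply_right, Function.update_of_ne hkp.symm]
        exact Or.inl hp
      · rw [Equiv.swap_apply_of_ne_of_ne hqp hqk, Function.update_of_ne hqk]
        exact Or.inr (Or.inl rfl)

/-- Description of the variables in the colon ideal `(J_f : f)` for a
minimal generator `f = ∏_{i : λ i > 0} z_{σ i, λ i}` of a sparse symmetric shifted ideal `J`,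
where `λ` is the associated partition of `f` and `maxf = max {σ k : λ k = λ s}`. -/
theorem colon_vars_iff {K : Type*} [Field K] (s b : ℕ) (hs : 0 < s)
    (J : Ideal (MvPolynomial (Fin s × Fin b) K)) (hJ : IsSSS K s b J)
    (lam : Fin s → ℕ) (hmono : Monotone lam) (hlb : ∀ i, lam i ≤ b)
    (σ : Equiv.Perm (Fin s))
    (hgen : IsMinSparseGen K s b J (lam ∘ σ.symm))
    (maxf : Fin s)
    (hm1 : ∃ k : Fin s, lam k = lam ⟨s - 1, by omega⟩ ∧ σ k = maxf)
    (hm2 : ∀ k : Fin s, lam k = lam ⟨s - 1, by omega⟩ → σ k ≤ maxf)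
    (p : Fin s × Fin b) :
    X p ∈ Submodule.colon (Jf K s b J (lam ∘ σ.symm))
        (Ideal.span {sparseMon K s b (lam ∘ σ.symm)}) ↔
      ∃ i : Fin s, p.1 = σ i ∧
        ((0 < lam i ∧ (p.2 : ℕ) + 1 < lam i) ∨
         (lam i = 0 ∧ (p.2 : ℕ) + 1 < lam ⟨s - 1, by omega⟩) ∨
         (lam i = 0 ∧ (p.2 : ℕ) + 1 = lam ⟨s - 1, by omega⟩ ∧ p.1 < maxf)) := by
  have hlast : ∀ i, lam i ≤ lam ⟨s - 1, by omega⟩ := fun i =>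
    hmono (Fin.mk_le_mk.2 (by omega))
  obtain ⟨i, hi⟩ := σ.surjective p.1
  have hνp : (lam ∘ σ.symm) p.1 = lam i := by simp [← hi]
  have hex : ∀ P : Fin s → Prop, (∃ i', p.1 = σ i' ∧ P i') ↔ P i := fun P =>
    ⟨fun ⟨i', h, hP⟩ => by rwa [σ.injective (hi.trans h)], fun hP => ⟨i, hi.symm, hP⟩⟩
  rw [hex]
  rcases Nat.eq_zero_or_pos (lam i) with h0 | hpos
  · rw [mem_colon_Jf_iff_of_eq_zero hJ hgen (hνp.trans h0)]
    simp only [h0, lt_irrefl, false_and, false_or, true_and, Function.comp_apply]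
    constructor
    · rintro ⟨k, hk⟩
      have h1 := hlast (σ.symm k)
      rcases hk with hk | ⟨hk, hlt⟩
      · exact Or.inl (by omega)
      · rcases h1.lt_or_eq with h1 | h1
        · exact Or.inl (by omega)
        · refine Or.inr ⟨by omega, hlt.trans_le ?_⟩
          simpa using hm2 _ h1
    · obtain ⟨k, hk, rfl⟩ := hm1
      refine fun h => ⟨σ k, ?_⟩
      rwa [Equiv.symm_apply_apply, hk]
  · rw [mem_colon_Jf_iff_of_pos hJ hgen (by omega), hνp]
    simp [hpos, hpos.ne']
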